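/- Suppose k is odd and s is a rational number with [m_1, …, m_{k−1}] < s < [m_1, …, m_k, 2n−2]. Then there exists an integer d with 1 ≤ d ≤ 2n−3 such that CS(s) contains (m+1, S_{2e}, d⟨S_1, S_2⟩, S_1, S_{2b}, m+1) as a subsequence. -/

import Mathlib

/- Formalization of statements from "Homotopically equivalent simple loops on
2-bridge spheres in Heckoid orbifolds for 2-bridge links (II)" by Lee-Sakuma.

We work in the free group `F` on two generators `a = gen 0`, `b = gen 1`.
For a rational `s` (in lowest terms `q/p`, with `0 ≤ s ≤ 1`), `uWord s` is the
word `u_s = a b^{ε₁} a^{ε₂} ⋯ b^{ε_{2p-1}}` with `ε_i = (-1)^⌊i·s⌋`.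
`CS s` is (a linear representative of) the cyclic sequence of lengths of
maximal constant-sign runs of exponents of `u_s`; since `u_s` begins with a
positive letter and (for `0 < s ≤ 1`) ends with a negative letter, the linear
run-length sequence represents the cyclic one.  `CyclicContains L T` says the
cyclic sequence represented by `L` contains `T` as a block of consecutive
terms.  `cfQ [m₁,…,m_k]` is the continued fraction `1/(m₁+1/(m₂+⋯+1/m_k))`.
`memI1 M n s` / `memI2 M n s` express `s ∈ I₁(r;n)` / `s ∈ I₂(r;n)` where
`r = cfQ M`, and `memI1hat` / `memI2hat` express `s ∈ I₁(r)` / `s ∈ I₂(r)`.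
The Heckoid group `Heck(r;n) = ⟨a,b | u_r^n⟩` is the quotient of `F` by the
normal closure `heckN r n` of `u_r^n`, with quotient map `heckQ r n`. -/

namespace Heckoid

abbrev F : Type := FreeGroup (Fin 2)

/-- The generators: `gen 0 = a`, `gen 1 = b` (and `gen i` depends on parity). -/
def gen (i : ℕ) : F := FreeGroup.of ⟨i % 2, Nat.mod_lt _ (by norm_num)⟩

/-- The word `u_s = a b^{ε₁} a^{ε₂} b^{ε₃} ⋯ a^{ε_{2p-2}} b^{ε_{2p-1}}`,
where `s = q/p` in lowest terms and `ε_i = (-1)^⌊iq/p⌋`. -/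
def uWord (s : ℚ) : F :=
  ((List.range (2 * s.den)).map
    (fun i => gen i ^ ((-1 : ℤ) ^ (⌊(i : ℚ) * s⌋.toNat)))).prod

/-- The sequence of exponent signs `ε₀, ε₁, …, ε_{2p-1}` of `u_s`. -/
def signList (s : ℚ) : List ℤ :=
  (List.range (2 * s.den)).map (fun i => (-1 : ℤ) ^ (⌊(i : ℚ) * s⌋.toNat))

/-- Lengths of the maximal runs of equal consecutive entries. -/
def runLengths {α : Type} [BEq α] (l : List α) : List ℕ :=
  (l.splitBy (· == ·)).map List.length

/-- `CS s = CS(u_s)`: the cyclic sequence of lengths of maximal constant-sign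
runs of `u_s`, represented by a list. -/
def CS (s : ℚ) : List ℕ := runLengths (signList s)

/-- The cyclic sequence represented by `L` contains `T` as a block of
consecutive terms. -/
def CyclicContains (L T : List ℕ) : Prop := ∃ k, T <+: L.rotate k

/-- The continued fraction `[m₁, m₂, …, m_k] = 1/(m₁+1/(m₂+⋯+1/m_k))`. -/
def cfQ : List ℕ → ℚ
  | [] => 0
  | a :: l => 1 / ((a : ℚ) + cfQ l)

/-- `d⟨T, T'⟩`: `d` consecutive repetitions of the concatenation of `T` and `T'`. -/
def rep2 (d : ℕ) (T T' : List ℕ) : List ℕ := (List.replicate d (T ++ T')).flatten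

/-- `s ∈ I₁(r;n)` where `r = cfQ M`:  `[0, [m₁,…,m_{k-1},m_k-1,2]]` for `k` even,
`[0, [m₁,…,m_k,2n-2])` for `k` odd. -/
def memI1 (M : List ℕ) (n : ℕ) (s : ℚ) : Prop :=
  if Even M.length then 0 ≤ s ∧ s ≤ cfQ (M.dropLast ++ [M.getLast! - 1, 2])
  else 0 ≤ s ∧ s < cfQ (M ++ [2 * n - 2])

/-- `s ∈ I₂(r;n)` where `r = cfQ M`: `([m₁,…,m_k,2n-2], 1]` for `k` even,
`[[m₁,…,m_{k-1},m_k-1,2], 1]` for `k` odd. -/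
def memI2 (M : List ℕ) (n : ℕ) (s : ℚ) : Prop :=
  if Even M.length then cfQ (M ++ [2 * n - 2]) < s ∧ s ≤ 1
  else cfQ (M.dropLast ++ [M.getLast! - 1, 2]) ≤ s ∧ s ≤ 1

/-- `s ∈ I₁(r)` where `r = cfQ M`. -/
def memI1hat (M : List ℕ) (s : ℚ) : Prop :=
  if Even M.length then 0 ≤ s ∧ s ≤ cfQ (M.dropLast ++ [M.getLast! - 1])
  else 0 ≤ s ∧ s ≤ cfQ M.dropLast

/-- `s ∈ I₂(r)` where `r = cfQ M`. -/
def memI2hat (M : List ℕ) (s : ℚ) : Prop :=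
  if Even M.length then cfQ M.dropLast ≤ s ∧ s ≤ 1
  else cfQ (M.dropLast ++ [M.getLast! - 1]) ≤ s ∧ s ≤ 1

/-- The window of length `n` starting at index `i` of a bi-infinite sequence. -/
def window (f : ℤ → ℕ) (i : ℤ) (n : ℕ) : List ℕ := (List.range n).map fun t : ℕ => f (i + t)

/-- Consecutive differences of `j ↦ ⌈j * x⌉`. -/
def ceilDiff (x : ℚ) (j : ℤ) : ℕ := (⌈((j + 1 : ℤ) : ℚ) * x⌉ - ⌈(j : ℚ) * x⌉).toNat

/-- Consecutive differences of `j ↦ ⌊j * x⌋`. -/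
def floorDiff (x : ℚ) (j : ℤ) : ℕ := (⌊((j + 1 : ℤ) : ℚ) * x⌋ - ⌊(j : ℚ) * x⌋).toNat

lemma length_window (f : ℤ → ℕ) (i : ℤ) (n : ℕ) : (window f i n).length = n := by
  simp [window]

lemma window_add (f : ℤ → ℕ) (i : ℤ) (n n' : ℕ) :
    window f i (n + n') = window f i n ++ window f (i + n) n' := by
  simp [window, List.range_add, add_assoc]

lemma window_one (f : ℤ → ℕ) (i : ℤ) : window f i 1 = [f i] := by
  simp [window, List.range_succ]

lemma window_congr {f g : ℤ → ℕ} {i j : ℤ} {n : ℕ}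
    (h : ∀ t : ℕ, t < n → f (i + t) = g (j + t)) : window f i n = window g j n := by
  simpa [window] using h

lemma apply_eq_of_window_eq {f g : ℤ → ℕ} {i j : ℤ} {n : ℕ} (h : window f i n = window g j n)
    {t : ℕ} (ht : t < n) : f (i + t) = g (j + t) := by
  simp only [window, List.map_inj_left, List.mem_range] at h
  exact h t ht

/-- A window of a periodic sequence covering one period represents the cyclic sequence containing
every shorter window. -/
lemma cyclicContains_window {f : ℤ → ℕ} {n k l : ℕ} (hf : ∀ j, f (j + n) = f j) (hk : k ≤ n)
    (hl : l ≤ n) : CyclicContains (window f 0 n) (window f k l) := by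
  refine ⟨k, ?_⟩
  obtain ⟨c, rfl⟩ := Nat.exists_eq_add_of_le hk
  have hrot : (window f 0 (k + c)).rotate k = window f k (k + c) := by
    have h := List.rotate_append_length_eq (window f 0 k) (window f k c)
    rw [length_window] at h
    rw [window_add, zero_add, h, add_comm k c, window_add]
    congr 1
    refine window_congr fun t _ => ?_
    rw [← hf (0 + t)]
    congr 1
    push_cast
    ring
  rw [hrot]
  obtain ⟨e, he⟩ := Nat.exists_eq_add_of_le hl
  rw [he, window_add]
  exact List.prefix_append _ _

lemma ceilDiff_cast {x : ℚ} (hx : 0 ≤ x) (j : ℤ) :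
    (ceilDiff x j : ℤ) = ⌈((j + 1 : ℤ) : ℚ) * x⌉ - ⌈(j : ℚ) * x⌉ := by
  refine Int.toNat_of_nonneg (sub_nonneg.2 (Int.ceil_le_ceil ?_))
  push_cast
  nlinarith

lemma floorDiff_cast {x : ℚ} (hx : 0 ≤ x) (j : ℤ) :
    (floorDiff x j : ℤ) = ⌊((j + 1 : ℤ) : ℚ) * x⌋ - ⌊(j : ℚ) * x⌋ := by
  refine Int.toNat_of_nonneg (sub_nonneg.2 (Int.floor_le_floor ?_))
  push_cast
  nlinarith

lemma ceil_add_mul {x : ℚ} {p q : ℤ} (h : q * x = p) (j : ℤ) :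
    ⌈((j + q : ℤ) : ℚ) * x⌉ = ⌈(j : ℚ) * x⌉ + p := by
  rw [← Int.ceil_add_intCast]
  congr 1
  push_cast
  linarith

lemma floor_add_mul {x : ℚ} {p q : ℤ} (h : q * x = p) (j : ℤ) :
    ⌊((j + q : ℤ) : ℚ) * x⌋ = ⌊(j : ℚ) * x⌋ + p := by
  rw [← Int.floor_add_intCast]
  congr 1
  push_cast
  linarith

lemma ceilDiff_periodic {x : ℚ} {p q : ℤ} (h : q * x = p) (j : ℤ) :
    ceilDiff x (j + q) = ceilDiff x j := by
  unfold ceilDiff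
  rw [add_right_comm, ceil_add_mul h, ceil_add_mul h]
  congr 1
  ring

lemma floorDiff_periodic {x : ℚ} {p q : ℤ} (h : q * x = p) (j : ℤ) :
    floorDiff x (j + q) = floorDiff x j := by
  unfold floorDiff
  rw [add_right_comm, floor_add_mul h, floor_add_mul h]
  congr 1
  ring

/-- Reflecting the ceiling differences over a period gives the floor differences. -/
lemma ceilDiff_reflect {x : ℚ} {p q : ℤ} (h : q * x = p) (j : ℤ) :
    ceilDiff x (q - 1 - j) = floorDiff x j := by
  have key (i : ℤ) : ⌈((q - i : ℤ) : ℚ) * x⌉ = p - ⌊(i : ℚ) * x⌋ := by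
    have : ((q - i : ℤ) : ℚ) * x = -((i : ℚ) * x) + p := by push_cast; linarith
    rw [this, Int.ceil_add_intCast, Int.ceil_neg]
    ring
  unfold ceilDiff floorDiff
  rw [show q - 1 - j + 1 = q - j by ring, show q - 1 - j = q - (j + 1) by ring, key, key]
  congr 1
  ring

lemma runLengths_flatten_replicate (f : ℕ → ℕ) (g : ℕ → ℤ) (n : ℕ) (hf : ∀ j, 0 < f j)
    (hg : ∀ j, g j ≠ g (j + 1)) :
    runLengths ((List.range n).map fun j => List.replicate (f j) (g j)).flatten =
      (List.range n).map f := by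
  rw [runLengths, List.splitBy_flatten]
  · simp [Function.comp_def]
  · simp only [List.mem_map, List.mem_range, List.replicate_eq_nil_iff, not_exists, not_and]
    exact fun j _ => (hf j).ne'
  · simp only [List.mem_map, List.mem_range, forall_exists_index, and_imp]
    rintro _ j _ rfl
    exact List.isChain_replicate_of_rel _ (by simp)
  · rw [List.isChain_map, List.isChain_range]
    intro j _
    have h0 (i : ℕ) : List.replicate (f i) (g i) ≠ [] := by
      simpa using (hf i).ne'
    refine ⟨h0 _, h0 _, ?_⟩
    simpa using hg j

lemma signList_eq (s : ℚ) :
    signList s = (List.range (2 * s.den)).map (fun i : ℕ => (-1 : ℤ) ^ (⌊(i : ℚ) * s⌋.toNat)) := by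
  simp only [signList, List.bind_eq_flatMap, List.pure_def, List.map_flatMap, List.map_cons,
    List.map_nil]
  exact List.map_eq_flatMap.symm

lemma signs_eq_flatten {s : ℚ} (hs0 : 0 < s) (n : ℕ) :
    (List.range ⌈(n : ℚ) * s⁻¹⌉.toNat).map (fun i : ℕ => (-1 : ℤ) ^ (⌊(i : ℚ) * s⌋.toNat)) =
      ((List.range n).map fun j : ℕ =>
        List.replicate (ceilDiff s⁻¹ (0 + j)) ((-1 : ℤ) ^ j)).flatten := by
  induction n with
  | zero => simp
  | succ n ih =>
    have hx : 0 < s⁻¹ := inv_pos.2 hs0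
    have hnn : 0 ≤ ⌈(n : ℚ) * s⁻¹⌉ := Int.ceil_nonneg (by positivity)
    have hd := ceilDiff_cast hx.le (n : ℤ)
    have hlen : ⌈((n + 1 : ℕ) : ℚ) * s⁻¹⌉.toNat = ⌈(n : ℚ) * s⁻¹⌉.toNat + ceilDiff s⁻¹ n := by
      push_cast at hd ⊢
      omega
    rw [hlen, List.range_add, List.map_append, ih, List.range_succ, List.map_append,
      List.flatten_append]
    congr 1
    simp only [List.map_map, List.map_cons, List.map_nil, List.flatten_cons, List.flatten_nil,
      List.append_nil, zero_add]
    rw [List.eq_replicate_iff]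
    refine ⟨by simp, ?_⟩
    simp only [List.mem_map, List.mem_range, forall_exists_index, and_imp]
    rintro _ i hi rfl
    have hfl : ⌊((⌈(n : ℚ) * s⁻¹⌉.toNat + i : ℕ) : ℚ) * s⌋ = n := by
      have e1 : ((⌈(n : ℚ) * s⁻¹⌉.toNat : ℕ) : ℚ) = (⌈(n : ℚ) * s⁻¹⌉ : ℤ) := by
        exact_mod_cast Int.toNat_of_nonneg hnn
      have hlow := Int.le_ceil ((n : ℚ) * s⁻¹)
      have hup := Int.ceil_lt_add_one (((n : ℤ) + 1 : ℤ) * s⁻¹ : ℚ)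
      have hi' : ⌈(n : ℚ) * s⁻¹⌉ + i + 1 ≤ ⌈(((n : ℤ) + 1 : ℤ) * s⁻¹ : ℚ)⌉ := by
        push_cast at hd ⊢
        omega
      have hi'' : (⌈(n : ℚ) * s⁻¹⌉ + i + 1 : ℚ) ≤ (⌈(((n : ℤ) + 1 : ℤ) * s⁻¹ : ℚ)⌉ : ℚ) := by
        exact_mod_cast hi'
      rw [Int.floor_eq_iff]
      push_cast [e1] at hup hi'' ⊢
      simp only [← div_eq_mul_inv] at hlow hup hi'' ⊢
      constructor
      · rw [← div_le_iff₀ hs0]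
        have : (0 : ℚ) ≤ i := by positivity
        linarith
      · rw [← lt_div_iff₀ hs0]
        linarith
    simp only [Function.comp_apply, hfl, Int.toNat_natCast]

/-- `CS s` is given by the ceiling differences of the inverse slope over two periods. -/
lemma CS_eq_window {s : ℚ} {q : ℕ} (hs0 : 0 < s) (hs1 : s ≤ 1)
    (hq : s.num = q) : CS s = window (ceilDiff s⁻¹) 0 (2 * q) := by
  have hx : 1 ≤ s⁻¹ := (one_le_inv₀ hs0).2 hs1
  have hlen : ⌈((2 * q : ℕ) : ℚ) * s⁻¹⌉.toNat = 2 * s.den := by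
    have : ((2 * q : ℕ) : ℚ) * s⁻¹ = ((2 * s.den : ℕ) : ℤ) := by
      have h1 : (q : ℚ) = s * s.den := by
        rw [Rat.mul_den_eq_num, hq]
        simp
      push_cast
      rw [h1]
      field_simp
    rw [this, Int.ceil_intCast, Int.toNat_natCast]
  rw [CS, signList_eq, ← hlen, signs_eq_flatten hs0, runLengths_flatten_replicate]
  · rfl
  · intro j
    have := ceilDiff_cast (by linarith) (0 + j : ℤ) (x := s⁻¹)
    have h2 : ⌈((0 + j : ℤ) : ℚ) * s⁻¹⌉ + 1 ≤ ⌈((0 + j + 1 : ℤ) : ℚ) * s⁻¹⌉ := by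
      rw [← Int.ceil_add_one]
      refine Int.ceil_le_ceil ?_
      push_cast
      linarith
    omega
  · intro j
    rw [pow_succ]
    have : (-1 : ℤ) ^ j ≠ 0 := by simp
    omega

lemma cfQ_append (l : List ℕ) (hl : ∀ x ∈ l, 0 < x) :
    ∃ a a' b b' : ℕ, 0 < b ∧ a' * b = a * b' + (-1 : ℤ) ^ l.length ∧
      (l ≠ [] → 0 < a ∧ a ≤ b ∧ a' ≤ b') ∧
      ∀ t : List ℕ, cfQ (l ++ t) = (a + a' * cfQ t) / (b + b' * cfQ t) := by
  have hnn (t : List ℕ) : 0 ≤ cfQ t := by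
    induction t with
    | nil => simp [cfQ]
    | cons c t ih => simp only [cfQ]; positivity
  induction l with
  | nil => exact ⟨0, 1, 1, 0, by simp⟩
  | cons c l ih =>
    obtain ⟨a, a', b, b', hb, hdet, -, h⟩ := ih fun x hx => hl x (List.mem_cons_of_mem _ hx)
    have hc : 0 < c := hl c (by simp)
    refine ⟨b, b', c * b + a, c * b' + a', by positivity, ?_, fun _ => ⟨hb, ?_, ?_⟩, fun t => ?_⟩
    · push_cast [List.length_cons, pow_succ]
      linarith
    · nlinarith
    · nlinarith
    · have ht := hnn t
      have hb' : (0 : ℚ) < b := by exact_mod_cast hb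
      have h1 : (0 : ℚ) < b + b' * cfQ t := by positivity
      have h2 : (0 : ℚ) < c * (b + b' * cfQ t) + (a + a' * cfQ t) := by positivity
      simp only [List.cons_append, cfQ, h]
      have h3 : ((c * b + a : ℕ) : ℚ) + ((c * b' + a' : ℕ) : ℚ) * cfQ t =
          c * (b + b' * cfQ t) + (a + a' * cfQ t) := by push_cast; ring
      rw [h3]
      field_simp

/-- The neighbours of a continued fraction of odd length at least two. -/
lemma exists_convergents (M : List ℕ) (hMlen : 2 ≤ M.length) (hMpos : ∀ x ∈ M, 0 < x)
    (hMlast : 2 ≤ M.getLast!) (hk : ¬ Even M.length) :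
    ∃ a b p q : ℕ, 0 < a ∧ a < q ∧ q ≤ p ∧ b * q = a * p + 1 ∧ cfQ M.dropLast = a / b ∧
      cfQ M = q / p ∧ ∀ c : ℕ, 0 < c → cfQ (M ++ [c]) = (c * q + a) / (c * p + b) := by
  have hM : M ≠ [] := by rintro rfl; simp at hMlen
  obtain ⟨l, z, rfl⟩ : ∃ l z, M = l ++ [z] := ⟨_, _, (List.dropLast_append_getLast hM).symm⟩
  have hl : l ≠ [] := by rintro rfl; simp at hMlen
  have hz : 2 ≤ z := by simpa using hMlast
  obtain ⟨a, a', b, b', hb, hdet, hle, h⟩ := cfQ_append l fun x hx => hMpos x (by simp [hx])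
  obtain ⟨ha, hab, hab'⟩ := hle hl
  have heven : Even l.length := by simpa [Nat.even_add_one] using hk
  rw [heven.neg_one_pow] at hdet
  have hz0 : (0 : ℚ) < z := by positivity
  have hb0 : (0 : ℚ) < b := by exact_mod_cast hb
  refine ⟨a, b, z * b + b', z * a + a', ha, by nlinarith, by nlinarith, ?_, ?_, ?_, ?_⟩
  · zify
    linarith
  · simpa [cfQ] using h []
  · rw [h]
    simp only [cfQ, add_zero]
    push_cast
    field_simp
  · intro c hc
    have hc0 : (0 : ℚ) < c := by exact_mod_cast hc
    rw [List.append_assoc, h]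
    simp only [cfQ, List.cons_append, List.nil_append, add_zero]
    push_cast
    field_simp
    ring

/-- Between neighbouring fractions `p / q` and `B / A` there is no fraction of denominator
less than `q + A`. -/
lemma mul_le_floor_add_one {x y : ℚ} {p q A B : ℤ} (hq : 0 < q) (hA : 0 < A) (hx : q * x = p)
    (hdet : B * q = A * p + 1) (hy : A * y ≤ B) {t : ℤ} (ht : 0 < t) (htq : t < q + A) :
    t * y ≤ ⌊t * x⌋ + 1 ∧ (A * y < B → t * y < ⌊t * x⌋ + 1) := by
  have hq' : (0 : ℚ) < q := by exact_mod_cast hq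
  have hA' : (0 : ℚ) < A := by exact_mod_cast hA
  have ht' : (0 : ℚ) < t := by exact_mod_cast ht
  set u := ⌊t * x⌋ + 1 with hu
  have hux : t * x < u := by
    rw [hu]; push_cast; exact Int.lt_floor_add_one _
  have h1 : t * p + 1 ≤ u * q := by
    have : (t * p : ℚ) < u * q := by rw [← hx]; nlinarith
    exact_mod_cast this
  have h2 : B * t ≤ A * u := by
    by_contra! hlt
    nlinarith [mul_le_mul_of_nonneg_left (Int.add_one_le_of_lt hlt) hq.le]
  have h2' : (B * t : ℚ) ≤ A * u := by exact_mod_cast h2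
  have hcast : (⌊t * x⌋ + 1 : ℚ) = u := by rw [hu]; push_cast; rfl
  rw [hcast]
  constructor
  · refine le_of_mul_le_mul_left ?_ hA'
    nlinarith
  · intro hlt
    refine lt_of_mul_lt_mul_left ?_ hA'.le
    nlinarith

lemma reverse_window (f : ℤ → ℕ) (n : ℕ) :
    (window f 0 n).reverse = window (fun j => f (n - 1 - j)) 0 n := by
  refine List.ext_getElem (by simp [window]) fun i h1 h2 => ?_
  have hi : i < n := by simpa [window] using h2
  simp only [window, List.getElem_reverse, List.getElem_map, List.getElem_range, List.length_map,
    List.length_range, zero_add]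
  congr 1
  omega

/-- The two palindromes composing a period of the ceiling differences are windows of the floor
differences. -/
lemma palindromes_eq_window {x : ℚ} {a b p q : ℕ} (hx0 : 0 ≤ x) (hx : q * x = p) (ha : 0 < a)
    (haq : a < q) (hdet : b * q = a * p + 1) {S1 S2 : List ℕ}
    (hdec : window (ceilDiff x) 0 (2 * q) = S1 ++ S2 ++ S1 ++ S2) (hS1ne : S1 ≠ [])
    (hS2ne : S2 ≠ []) (hS1pal : S1.reverse = S1) (hS2pal : S2.reverse = S2) :
    S2 = window (floorDiff x) 0 a ∧ S1 = window (floorDiff x) a (q - a) := by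
  have hxz : ((q : ℤ) : ℚ) * x = (p : ℤ) := by exact_mod_cast hx
  have h1 : 0 < S1.length := List.length_pos_of_ne_nil hS1ne
  have h2 : 0 < S2.length := List.length_pos_of_ne_nil hS2ne
  have hlen : S1.length + S2.length = q := by
    have := congrArg List.length hdec
    simp only [length_window, List.length_append] at this
    omega
  have hfirst : S1 ++ S2 = window (ceilDiff x) 0 q := by
    rw [two_mul, window_add, List.append_assoc (S1 ++ S2)] at hdec
    exact ((List.append_inj hdec (by simp [length_window, hlen])).1).symm
  have hswap_floor : S2 ++ S1 = window (floorDiff x) 0 q := by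
    have := congrArg List.reverse hfirst
    rw [List.reverse_append, hS1pal, hS2pal, reverse_window] at this
    rw [this]
    exact window_congr fun t _ => by rw [← ceilDiff_reflect hxz]
  have hparts : S1 = window (ceilDiff x) 0 S1.length ∧
      S2 = window (ceilDiff x) S1.length S2.length := by
    rw [← hlen, window_add, zero_add] at hfirst
    exact List.append_inj hfirst (by simp [length_window])
  have hswap_ceil : S2 ++ S1 = window (ceilDiff x) S1.length q := by
    rw [← hlen, add_comm S1.length S2.length, window_add, ← hparts.2]
    congr 1
    rw [← Nat.cast_add, hlen]
    refine hparts.1.trans (window_congr fun t _ => ?_)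
    rw [← ceilDiff_periodic hxz]
    congr 1
    ring
  have hdiff (t : ℕ) (ht : t < q) : ceilDiff x (S1.length + t) = floorDiff x (0 + t) :=
    apply_eq_of_window_eq (hswap_ceil.symm.trans hswap_floor) ht
  have hsum (t : ℕ) (ht : t ≤ q) :
      ⌈((S1.length + t : ℤ) : ℚ) * x⌉ = ⌈((S1.length : ℤ) : ℚ) * x⌉ + ⌊((t : ℤ) : ℚ) * x⌋ := by
    induction t with
    | zero => simp
    | succ t ih =>
      have e := hdiff t ht
      have e1 := ceilDiff_cast hx0 (S1.length + t)
      have e2 := floorDiff_cast hx0 (0 + t)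
      have e3 := ih (by omega)
      rw [zero_add] at e e2
      rw [e, e2] at e1
      rw [Nat.cast_succ, ← add_assoc]
      linarith
  have hq : (0 : ℚ) < q := by exact_mod_cast (by omega : 0 < q)
  have hdetq : (b * q : ℚ) = a * p + 1 := by exact_mod_cast hdet
  have hax : (a : ℚ) * x = b - 1 / q := by
    field_simp
    rw [hdetq, ← hx]
    ring
  have hq1 : (1 : ℚ) / q ≤ 1 := by
    rw [div_le_one hq]
    exact_mod_cast (by omega : 1 ≤ q)
  have hfl : ⌊((a : ℤ) : ℚ) * x⌋ = b - 1 := by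
    rw [Int.floor_eq_iff]
    push_cast
    rw [hax]
    have : (0 : ℚ) < 1 / q := by positivity
    constructor <;> linarith
  have hL : S1.length + a = q := by
    have e := hsum a haq.le
    rw [hfl] at e
    set c := ⌈((S1.length : ℤ) : ℚ) * x⌉ with hc
    have u1 : ((S1.length : ℤ) : ℚ) * x ≤ c := Int.le_ceil _
    have u2 : ((c + (b - 1) : ℤ) : ℚ) ≥ ((S1.length + a : ℤ) : ℚ) * x := e ▸ Int.le_ceil _
    have u3 : (c : ℚ) < ((S1.length : ℤ) : ℚ) * x + 1 := Int.ceil_lt_add_one _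
    push_cast at u1 u2 u3
    have u4 : (c : ℚ) * q < S1.length * p + q := by
      rw [← hx]; nlinarith
    have u5 : (S1.length : ℚ) * p + q ≤ c * q + 1 := by
      have : (S1.length : ℚ) * x + 1 ≤ c + 1 / q := by linarith
      have := mul_le_mul_of_nonneg_right this hq.le
      rw [add_mul, add_mul, one_div, inv_mul_cancel₀ hq.ne', ← hx] at *
      linarith
    have v4 : c * q < S1.length * p + q := by exact_mod_cast u4
    have v5 : (S1.length * p + q : ℤ) ≤ c * q + 1 := by exact_mod_cast u5
    have v : (S1.length * p + q : ℤ) = c * q + 1 := by omega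
    have hdetz : (b * q : ℤ) = a * p + 1 := by exact_mod_cast hdet
    have hdvd : (q : ℤ) ∣ (S1.length + a) := by
      have hcop : IsCoprime (q : ℤ) p := ⟨b, -a, by linarith⟩
      refine hcop.dvd_of_dvd_mul_right ⟨c - 1 + b, ?_⟩
      linarith
    obtain ⟨k, hk⟩ := hdvd
    have hk1 : 0 < k := by
      by_contra! hneg
      nlinarith
    have hk2 : k < 2 := by
      by_contra! hneg
      have : (S1.length : ℤ) + a < 2 * q := by omega
      nlinarith
    have : k = 1 := by omega
    subst this
    omega
  have hs : S2 ++ S1 = window (floorDiff x) 0 a ++ window (floorDiff x) a (q - a) := by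
    rw [hswap_floor, ← Nat.add_sub_cancel' haq.le, window_add, zero_add,
      Nat.add_sub_cancel' haq.le]
  exact List.append_inj hs (by rw [length_window]; omega)

lemma rep2_eq_window {x : ℚ} {p q a : ℕ} (hx : q * x = p) (haq : a < q) (d : ℕ) :
    rep2 d (window (floorDiff x) a (q - a)) (window (floorDiff x) 0 a) =
      window (floorDiff x) a (d * q) := by
  have hxz : ((q : ℤ) : ℚ) * x = (p : ℤ) := by exact_mod_cast hx
  have hstep (i : ℤ) (n : ℕ) : window (floorDiff x) (i + q) n = window (floorDiff x) i n :=
    window_congr fun t _ => by rw [← floorDiff_periodic hxz (i + t)]; congr 1; ring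
  induction d with
  | zero => simp [rep2, window]
  | succ d ih =>
    have h1 : window (floorDiff x) a q =
        window (floorDiff x) a (q - a) ++ window (floorDiff x) 0 a := by
      conv_lhs => rw [← Nat.sub_add_cancel haq.le, window_add]
      rw [← hstep 0 a]
      congr 2
      push_cast [Nat.cast_sub haq.le]
      ring
    rw [add_mul, one_mul, add_comm (d * q), window_add, hstep, ← ih, h1]
    simp [rep2, List.replicate_succ]

/-- The target sequence is a window of the floor differences with both end terms increased. -/
lemma block_eq_window {x : ℚ} {p q a m : ℕ} (hx : q * x = p) (ha : 0 < a) (haq : a < q)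
    {S1 S2 : List ℕ} (hS1 : S1 = window (floorDiff x) a (q - a))
    (hS2 : S2 = window (floorDiff x) 0 a) (d : ℕ) :
    [m + 1] ++ S2.tail ++ rep2 d S1 S2 ++ S1 ++ S2.dropLast ++ [m + 1] =
      [m + 1] ++ window (floorDiff x) 1 ((d + 1) * q + a - 2) ++ [m + 1] := by
  have hxz : ((q : ℤ) : ℚ) * x = (p : ℤ) := by exact_mod_cast hx
  have hstep (k : ℕ) (i : ℤ) (n : ℕ) :
      window (floorDiff x) (i + k * q) n = window (floorDiff x) i n := by
    induction k with
    | zero => simp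
    | succ k ih =>
      rw [← ih]
      refine window_congr fun t _ => ?_
      rw [← floorDiff_periodic hxz (i + k * q + t)]
      congr 1
      push_cast
      ring
  obtain ⟨c, rfl⟩ := Nat.exists_eq_succ_of_ne_zero ha.ne'
  have htail : S2.tail = window (floorDiff x) 1 c := by
    rw [hS2, Nat.succ_eq_add_one, add_comm c 1, window_add, window_one]
    simp
  have hdrop : S2.dropLast = window (floorDiff x) 0 c := by
    rw [hS2, Nat.succ_eq_add_one, window_add, window_one, List.dropLast_concat]
  have hN : (d + 1) * q + c.succ - 2 = c + d * q + (q - c.succ) + c := by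
    rw [add_mul, one_mul]
    omega
  have hr := rep2_eq_window hx haq d
  rw [← hS1, ← hS2] at hr
  rw [htail, hdrop, hr, hS1, hN, window_add, window_add, window_add,
    ← hstep d (c.succ : ℕ) (q - c.succ), ← hstep (d + 1) 0 c]
  simp only [List.append_assoc]
  congr 3
  · congr 1; push_cast; ring
  · congr 1
    · congr 1; push_cast; ring
    · congr 2; push_cast [Nat.cast_sub haq.le]; ring

lemma window_ceilDiff_eq {x y : ℚ} {m N : ℕ} (hx0 : 0 ≤ x) {j C : ℤ} (hN : 2 ≤ N)
    (hm1 : floorDiff x 0 = m) (hm2 : floorDiff x (N - 1) = m) (h0 : ⌈(j : ℚ) * y⌉ = C)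
    (hmid : ∀ t : ℤ, 0 < t → t < N → ⌈((j + t : ℤ) : ℚ) * y⌉ = C + ⌊(t : ℚ) * x⌋ + 1)
    (hlast : ⌈((j + N : ℤ) : ℚ) * y⌉ = C + ⌊((N : ℤ) : ℚ) * x⌋ + 2) :
    window (ceilDiff y) j N = [m + 1] ++ window (floorDiff x) 1 (N - 2) ++ [m + 1] := by
  obtain ⟨n, rfl⟩ := Nat.exists_eq_add_of_le hN
  have e0 := floorDiff_cast hx0 0
  have e1 := floorDiff_cast hx0 ((2 + n : ℕ) - 1)
  rw [hm1] at e0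
  rw [hm2] at e1
  rw [show 2 + n = 1 + n + 1 by ring, window_add, window_add, window_one, window_one]
  congr 1
  · congr 1
    · congr 1
      unfold ceilDiff
      rw [h0, hmid 1 (by omega) (by push_cast; omega)]
      simp only [zero_add, Int.cast_zero, zero_mul, Int.floor_zero] at e0
      omega
    · rw [show 1 + n + 1 - 2 = n by omega]
      refine window_congr fun t ht => ?_
      unfold ceilDiff floorDiff
      rw [show j + (1 : ℕ) + (t : ℤ) + 1 = j + (1 + t + 1) by push_cast; ring,
        show j + (1 : ℕ) + (t : ℤ) = j + (1 + t) by push_cast; ring,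
        hmid _ (by omega) (by push_cast; omega), hmid _ (by omega) (by push_cast; omega)]
      congr 1
      ring
  · congr 1
    unfold ceilDiff
    rw [show j + ((1 + n : ℕ) : ℤ) + 1 = j + (2 + n : ℕ) by push_cast; ring, hlast,
      hmid (1 + n : ℕ) (by omega) (by push_cast; omega)]
    rw [show ((2 + n : ℕ) : ℤ) - 1 + 1 = (2 + n : ℕ) by ring,
      show ((2 + n : ℕ) : ℤ) - 1 = (1 + n : ℕ) by push_cast; ring] at e1
    omega

lemma floor_neighbour_add {x : ℚ} {p q A B : ℤ} (hq : 0 < q) (hx : q * x = p)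
    (hdet : B * q = A * p + 1) (u : ℤ) :
    ⌊((A + u : ℤ) : ℚ) * x⌋ = B + ⌈(u : ℚ) * x⌉ - 1 := by
  have hq' : (0 : ℚ) < q := by exact_mod_cast hq
  set c := ⌈(u : ℚ) * x⌉ with hc
  have h1 : (u : ℚ) * x ≤ c := Int.le_ceil _
  have h2 : (c : ℚ) < u * x + 1 := Int.ceil_lt_add_one _
  have hdet' : (B * q : ℚ) = A * p + 1 := by exact_mod_cast hdet
  have hux : (u * x * q : ℚ) = u * p := by rw [← hx]; ring
  have h3 : u * p ≤ c * q := by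
    have : (u * p : ℚ) ≤ c * q := by rw [← hux]; gcongr
    exact_mod_cast this
  have h4 : c * q + 1 ≤ u * p + q := by
    have : (c * q : ℚ) < u * p + q := by
      rw [← hux]
      nlinarith
    exact_mod_cast this
  have h3' : (u * p : ℚ) ≤ c * q := by exact_mod_cast h3
  have h4' : (c * q + 1 : ℚ) ≤ u * p + q := by exact_mod_cast h4
  have hAu : ((A + u : ℤ) : ℚ) * x * q = B * q - 1 + u * p := by
    push_cast
    rw [hdet', ← hx]
    ring
  rw [Int.floor_eq_iff]
  constructor
  · refine le_of_mul_le_mul_right ?_ hq'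
    rw [hAu]
    push_cast
    linarith
  · refine lt_of_mul_lt_mul_right ?_ hq'.le
    rw [hAu]
    push_cast
    linarith

lemma floor_neighbour {x : ℚ} {p q A B : ℤ} (hq : 0 < q) (hx : q * x = p)
    (hdet : B * q = A * p + 1) : ⌊(A : ℚ) * x⌋ = B - 1 := by
  simpa using floor_neighbour_add hq hx hdet 0

lemma lt_of_mediant_lt {x y : ℚ} {p q A B : ℤ} (hq : 0 < q) (hA : 0 < A) (hx : q * x = p)
    (hdet : B * q = A * p + 1) (hlow : (B + p : ℚ) < (A + q) * y) : x < y := by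
  have hq' : (0 : ℚ) < q := by exact_mod_cast hq
  have hA' : (0 : ℚ) < A := by exact_mod_cast hA
  have hdet' : (B * q : ℚ) = A * p + 1 := by exact_mod_cast hdet
  have hAx : (A : ℚ) * x < B := by
    refine lt_of_mul_lt_mul_right ?_ hq'.le
    rw [hdet', ← hx]
    linarith
  refine lt_of_mul_lt_mul_left (a := (A + q : ℚ)) ?_ (by positivity)
  linarith

lemma ceil_eq_floor_add_one {x y : ℚ} {p q A B : ℤ} (hq : 0 < q) (hA : 0 < A) (hx : q * x = p)
    (hdet : B * q = A * p + 1) (hup : A * y ≤ B) (hxy : x < y) {t : ℤ} (ht : 0 < t)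
    (htq : t < q + A) : ⌈(t : ℚ) * y⌉ = ⌊(t : ℚ) * x⌋ + 1 := by
  have ht' : (0 : ℚ) < t := by exact_mod_cast ht
  have h := (mul_le_floor_add_one hq hA hx hdet hup ht htq).1
  have h1 : (⌊(t : ℚ) * x⌋ : ℚ) ≤ t * x := Int.floor_le _
  rw [Int.ceil_eq_iff]
  push_cast
  constructor
  · nlinarith
  · exact h

lemma le_num_of_neighbours {A B p q P Q : ℤ} (hA : 0 ≤ A) (hq : 0 ≤ q)
    (hdet : B * q = A * p + 1) {α β : ℤ} (hα : Q * (B + p) + α ≤ P * (A + q))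
    (hβ : P * A + β ≤ Q * B) : α * A + β * (A + q) ≤ Q := by
  have h1 := mul_le_mul_of_nonneg_right hα hA
  have h2 := mul_le_mul_of_nonneg_right hβ (add_nonneg hA hq)
  have h3 : Q * (B * q) = Q * (A * p + 1) := by rw [hdet]
  linarith

/-- The block occurs at the start of the period when the slope lies between the neighbour `A / B`
and its mediant with `q / p`. -/
lemma window_ceilDiff_of_between {x y : ℚ} {m A q : ℕ} {p B : ℤ} (hx0 : 0 ≤ x) (hq : 0 < q)
    (hA : 0 < A) (hx : q * x = p) (hdet : B * q = A * p + 1) (hup : A * y ≤ B)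
    (hlow : (B + p : ℚ) < (A + q) * y) (hm1 : floorDiff x 0 = m)
    (hm2 : floorDiff x (A - 1) = m) :
    window (ceilDiff y) 0 (q + A) = [m + 1] ++ window (floorDiff x) 1 (q + A - 2) ++ [m + 1] := by
  have hxz : ((q : ℤ) : ℚ) * x = p := by exact_mod_cast hx
  have hqz : (0 : ℤ) < q := by exact_mod_cast hq
  have hAz : (0 : ℤ) < A := by exact_mod_cast hA
  have hxy : x < y := lt_of_mediant_lt hqz hAz hxz hdet (by exact_mod_cast hlow)
  have hup' : ((A : ℤ) : ℚ) * y ≤ B := by exact_mod_cast hup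
  refine window_ceilDiff_eq (C := 0) hx0 (by omega) hm1 ?_ (by simp) (fun t ht htN => ?_) ?_
  · rw [← hm2, ← floorDiff_periodic hxz (A - 1)]
    congr 1
    push_cast
    ring
  · rw [zero_add, zero_add]
    exact ceil_eq_floor_add_one hqz hAz hxz hdet hup' hxy ht (by push_cast at htN; exact htN)
  · have hfl : ⌊(((q + A : ℕ) : ℤ) : ℚ) * x⌋ = B - 1 + p := by
      rw [Nat.cast_add, add_comm (q : ℤ), floor_add_mul hxz, floor_neighbour hqz hxz hdet]
    have hqy := (mul_le_floor_add_one hqz hAz hxz hdet hup' hqz (by omega)).1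
    rw [hxz, Int.floor_intCast] at hqy
    rw [hfl, Int.ceil_eq_iff]
    push_cast at hqy hup ⊢
    constructor <;> linarith

/-- The block with two copies of the period occurs when the slope lies between `A / B` and its
mediant with `q / p`, starting `q + A` terms before a period. -/
lemma window_ceilDiff_of_lt {x y : ℚ} {m A q : ℕ} {p B : ℤ} (hx0 : 0 ≤ x) (hq : 0 < q)
    (hA : 0 < A) (hx : q * x = p) (hdet : B * q = A * p + 1) (hup : A * y < B)
    (hlow : (B + p : ℚ) < (A + q) * y) (hm1 : floorDiff x 0 = m)
    (hm2 : floorDiff x (A - 1) = m) :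
    window (ceilDiff y) (-(q + A)) (2 * q + A) =
      [m + 1] ++ window (floorDiff x) 1 (2 * q + A - 2) ++ [m + 1] := by
  have hxz : ((q : ℤ) : ℚ) * x = p := by exact_mod_cast hx
  have hqz : (0 : ℤ) < q := by exact_mod_cast hq
  have hAz : (0 : ℤ) < A := by exact_mod_cast hA
  have hxy : x < y := lt_of_mediant_lt hqz hAz hxz hdet (by exact_mod_cast hlow)
  have hup' : ((A : ℤ) : ℚ) * y < B := by exact_mod_cast hup
  have hqy := (mul_le_floor_add_one hqz hAz hxz hdet hup'.le hqz (by omega)).1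
  rw [hxz, Int.floor_intCast] at hqy
  push_cast at hqy
  have hmed (u : ℤ) : ⌊((q + A + u : ℤ) : ℚ) * x⌋ = B + p + ⌈(u : ℚ) * x⌉ - 1 := by
    rw [show (q + A + u : ℤ) = A + u + q by ring, floor_add_mul hxz,
      floor_neighbour_add hqz hxz hdet]
    ring
  refine window_ceilDiff_eq (C := -(B + p)) hx0 (by omega) hm1 ?_ ?_ (fun t ht htN => ?_) ?_
  · rw [← hm2, ← floorDiff_periodic hxz (A - 1), ← floorDiff_periodic hxz (A - 1 + q)]
    congr 1
    push_cast
    ring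
  · rw [Int.ceil_eq_iff]
    push_cast
    constructor <;> linarith
  · obtain ⟨u, rfl⟩ : ∃ u : ℤ, t = q + A + u := ⟨t - (q + A), by ring⟩
    rw [hmed, show -((q : ℤ) + A) + (q + A + u) = u by ring]
    suffices h : ⌈(u : ℚ) * y⌉ = ⌈(u : ℚ) * x⌉ by rw [h]; ring
    rcases lt_trichotomy u 0 with hu | rfl | hu
    · obtain ⟨v, rfl⟩ : ∃ v, u = -v := ⟨-u, by ring⟩
      have hv : (0 : ℚ) < v := by exact_mod_cast (by omega : 0 < v)
      have h := (mul_le_floor_add_one hqz hAz hxz hdet hup'.le (t := v) (by omega) (by omega)).2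
        hup'
      have h1 : (⌊(v : ℚ) * x⌋ : ℚ) ≤ v * x := Int.floor_le _
      have h2 : ⌊(v : ℚ) * y⌋ = ⌊(v : ℚ) * x⌋ := by
        rw [Int.floor_eq_iff]
        constructor
        · nlinarith
        · exact h
      push_cast
      rw [neg_mul, neg_mul, Int.ceil_neg, Int.ceil_neg, h2]
    · simp
    · have huq : u < q := by push_cast at htN; omega
      rw [ceil_eq_floor_add_one hqz hAz hxz hdet hup'.le hxy hu (by omega)]
      have hle := Int.floor_le ((u : ℚ) * x)
      have hlt := Int.lt_floor_add_one ((u : ℚ) * x)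
      symm
      rw [Int.ceil_eq_iff]
      push_cast
      refine ⟨?_, hlt.le⟩
      rw [add_sub_cancel_right]
      refine lt_of_le_of_ne hle fun heq => ?_
      have hz : ⌊(u : ℚ) * x⌋ * q = u * p := by
        have : (⌊(u : ℚ) * x⌋ * q : ℚ) = u * p := by rw [heq, ← hx]; ring
        exact_mod_cast this
      have hcop : IsCoprime (q : ℤ) p := ⟨B, -A, by linarith⟩
      have hdvd : (q : ℤ) ∣ u :=
        hcop.dvd_of_dvd_mul_right ⟨⌊(u : ℚ) * x⌋, by rw [← hz]; ring⟩
      exact absurd (Int.le_of_dvd hu hdvd) (by omega)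
  · have hfl : ⌊(((2 * q + A : ℕ) : ℤ) : ℚ) * x⌋ = B + p + p - 1 := by
      have := hmed q
      rw [hxz, Int.ceil_intCast] at this
      rw [← this]
      congr 2
      push_cast
      ring
    rw [hfl, Int.ceil_eq_iff]
    push_cast
    constructor <;> linarith

lemma cyclicContains_CS {s : ℚ} {Q N : ℕ} {T : List ℕ} (hs0 : 0 < s) (hs1 : s ≤ 1)
    (hQ : s.num = Q) {k : ℕ} (hk : k ≤ 2 * Q) (hN : N ≤ 2 * Q)
    (hT : window (ceilDiff s⁻¹) k N = T) : CyclicContains (CS s) T := by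
  rw [CS_eq_window hs0 hs1 hQ, ← hT]
  refine cyclicContains_window (fun j => ?_) hk hN
  refine ceilDiff_periodic (p := 2 * s.den) ?_ j
  have h1 : (Q : ℚ) = s * s.den := by
    rw [Rat.mul_den_eq_num, hQ]
    simp
  push_cast
  rw [h1]
  field_simp

/-- The smallest index of a sequence of half-open conditions: either the condition holds at `1`,
or it first holds at some `d + 1` with `1 ≤ d`. -/
lemma exists_first_index {P : ℕ → Prop} {n : ℕ} (hn : 1 ≤ n) (hP : P n) :
    P 1 ∨ ∃ d, 1 ≤ d ∧ d + 1 ≤ n ∧ ¬ P d ∧ P (d + 1) := by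
  induction n, hn using Nat.le_induction with
  | base => exact Or.inl hP
  | succ n hn ih =>
    by_cases h : P n
    · rcases ih h with h | ⟨d, h1, h2, h3⟩
      · exact Or.inl h
      · exact Or.inr ⟨d, h1, by omega, h3⟩
    · exact Or.inr ⟨n, hn, le_rfl, h, hP⟩

/-- Lemma 2.5(2): if `k` is odd and `[m₁,…,m_{k-1}] < s < [m₁,…,m_k,2n-2]`,
then `CS(s)` contains `(m+1, S₂ₑ, d⟨S₁,S₂⟩, S₁, S₂_b, m+1)` as a subsequence,
for some `1 ≤ d ≤ 2n-3`, where `S₂ = (m, S₂ₑ) = (S₂_b, m)`. -/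
theorem statement8
    (M : List ℕ) (m n : ℕ) (r : ℚ)
    (hMlen : 2 ≤ M.length) (hMpos : ∀ x ∈ M, 0 < x) (hMlast : 2 ≤ M.getLast!)
    (hm : M.head? = some m) (hn : 2 ≤ n) (hr : r = cfQ M)
    (S1 S2 : List ℕ) (hdec : CS r = S1 ++ S2 ++ S1 ++ S2)
    (hS1ne : S1 ≠ []) (hS2ne : S2 ≠ [])
    (hS1pal : S1.reverse = S1) (hS2pal : S2.reverse = S2)
    (hS1h : S1.head? = some (m + 1)) (hS2h : S2.head? = some m)
    (hk : ¬ Even M.length) (s : ℚ)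
    (hs1 : cfQ M.dropLast < s)
    (hs2 : s < cfQ (M ++ [2 * n - 2])) :
    ∃ d : ℕ, 1 ≤ d ∧ d ≤ 2 * n - 3 ∧
      CyclicContains (CS s)
        ([m + 1] ++ S2.tail ++ rep2 d S1 S2 ++ S1 ++ S2.dropLast ++ [m + 1]) := by
  obtain ⟨a, b, p, q, ha, haq, hqp, hdet, hcf1, hcf, hcf2⟩ :=
    exists_convergents M hMlen hMpos hMlast hk
  have hq : 0 < q := by omega
  have hp : 0 < p := by omega
  have hb : 0 < b := by
    by_contra! h
    obtain rfl : b = 0 := by omega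
    omega
  have hq' : (0 : ℚ) < q := by exact_mod_cast hq
  have hp' : (0 : ℚ) < p := by exact_mod_cast hp
  have ha' : (0 : ℚ) < a := by exact_mod_cast ha
  have hb' : (0 : ℚ) < b := by exact_mod_cast hb
  have hdetz : (b * q : ℤ) = a * p + 1 := by exact_mod_cast hdet
  rw [hcf] at hr
  rw [hcf1] at hs1
  rw [hcf2 _ (by omega)] at hs2
  have hr0 : 0 < r := by rw [hr]; positivity
  have hr1 : r ≤ 1 := by
    rw [hr, div_le_one hp']
    exact_mod_cast hqp
  have hrnum : r.num = q := by
    have hcop : Nat.Coprime q p := by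
      rw [← Nat.isCoprime_iff_coprime]
      exact ⟨b, -a, by linarith⟩
    rw [hr]
    exact Rat.num_div_eq_of_coprime (by exact_mod_cast hp) hcop
  have hx : (q : ℚ) * r⁻¹ = p := by
    rw [hr]
    field_simp
  have hxz : ((q : ℤ) : ℚ) * r⁻¹ = (p : ℤ) := by exact_mod_cast hx
  have hx0 : 0 ≤ r⁻¹ := by positivity
  rw [CS_eq_window hr0 hr1 hrnum] at hdec
  obtain ⟨hS2, hS1⟩ := palindromes_eq_window hx0 hx ha haq hdet hdec hS1ne hS2ne hS1pal hS2pal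
  have hm1 : floorDiff r⁻¹ 0 = m := by
    obtain ⟨c, rfl⟩ := Nat.exists_eq_succ_of_ne_zero ha.ne'
    rw [hS2, Nat.succ_eq_add_one, add_comm c 1, window_add, window_one] at hS2h
    simpa using hS2h
  have hm2 : floorDiff r⁻¹ (a - 1) = m := by
    obtain ⟨c, rfl⟩ := Nat.exists_eq_succ_of_ne_zero ha.ne'
    rw [← hS2pal, hS2, Nat.succ_eq_add_one, window_add, window_one] at hS2h
    simpa using hS2h
  have hs0 : 0 < s := lt_trans (by positivity) hs1
  have hup (c : ℕ) : s < (c * q + a) / (c * p + b) → s < 1 := by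
    intro h
    refine h.trans_le ?_
    rw [div_le_one (by positivity)]
    have hab : a ≤ b := by nlinarith
    have : (a : ℚ) ≤ b := by exact_mod_cast hab
    have : (q : ℚ) ≤ p := by exact_mod_cast hqp
    gcongr
  have hs1' : s ≤ 1 := (hup _ hs2).le
  obtain ⟨Q, hQ⟩ := Int.eq_ofNat_of_zero_le (Rat.num_pos.2 hs0).le
  have hsQ : s = Q / s.den := by
    conv_lhs => rw [← Rat.num_div_den s, hQ]
    simp
  have hden : (0 : ℚ) < s.den := by exact_mod_cast s.den_pos
  have hQ0 : (0 : ℚ) < Q := by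
    have : 0 < s.num := Rat.num_pos.2 hs0
    exact_mod_cast hQ ▸ this
  have hy : s⁻¹ = s.den / Q := by
    conv_lhs => rw [hsQ]
    exact inv_div _ _
  have hlt (c e : ℚ) (he : 0 < e) : s < c / e ↔ e < c * s⁻¹ := by
    rw [lt_div_iff₀ he, ← div_eq_mul_inv, lt_div_iff₀ hs0, mul_comm]
  rcases exists_first_index (P := fun c : ℕ => s < (c * q + a) / (c * p + b)) (by omega) hs2 with
    h | ⟨d, hd1, hd2, hlow, hhigh⟩
  · have hlow : (b + p : ℚ) < (a + q) * s⁻¹ := by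
      have := (hlt _ _ (by positivity)).1 h
      push_cast at this
      linarith
    have hup : a * s⁻¹ < b := by
      rwa [← div_eq_mul_inv, div_lt_iff₀ hs0, mul_comm, ← div_lt_iff₀ hb']
    have hlen : q + 2 * a ≤ Q := by
      have hα : (Q * (b + p) + 1 : ℤ) ≤ s.den * (a + q) := by
        rw [hy, mul_div_assoc', lt_div_iff₀ hQ0] at hlow
        have : (Q * (b + p) : ℤ) < s.den * (a + q) := by
          have : (Q * (b + p) : ℚ) < s.den * (a + q) := by linarith
          exact_mod_cast this
        exact this
      have hβ : (s.den * a + 1 : ℤ) ≤ Q * b := by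
        rw [hy, mul_div_assoc', div_lt_iff₀ hQ0] at hup
        have : (s.den * a : ℤ) < Q * b := by
          have : (s.den * a : ℚ) < Q * b := by linarith
          exact_mod_cast this
        exact this
      have := le_num_of_neighbours (by omega) (by omega) hdetz hα hβ
      omega
    refine ⟨1, le_rfl, by omega, ?_⟩
    rw [block_eq_window hx ha haq hS1 hS2]
    refine cyclicContains_CS (k := 2 * Q - (q + a)) (N := 2 * q + a) hs0 hs1' hQ (by omega)
      (by omega) ?_
    rw [← window_ceilDiff_of_lt hx0 hq ha (by exact_mod_cast hx) hdetz (by exact_mod_cast hup)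
      (by exact_mod_cast hlow) hm1 hm2]
    refine window_congr fun t _ => ?_
    have hper : ((2 * Q : ℤ) : ℚ) * s⁻¹ = (2 * s.den : ℤ) := by
      rw [hy]
      push_cast
      field_simp
    rw [← ceilDiff_periodic hper (-(q + a) + t)]
    congr 1
    rw [Nat.cast_sub (by omega)]
    push_cast
    ring
  · set A := d * q + a with hA
    have hdetA : (((d * p + b : ℕ) : ℤ) * q : ℤ) = A * p + 1 := by
      rw [hA]
      push_cast
      linarith
    have hup : A * s⁻¹ ≤ (d * p + b : ℕ) := by
      rw [hlt _ _ (by positivity), not_lt] at hlow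
      rw [hA]
      push_cast
      exact hlow
    have hlow : ((d * p + b : ℕ) + p : ℚ) < (A + q) * s⁻¹ := by
      rw [hlt _ _ (by positivity)] at hhigh
      rw [hA]
      push_cast at hhigh ⊢
      linarith
    have hqA : q + a ≤ A := by
      have := Nat.mul_le_mul_right q hd1
      omega
    have hlen : A ≤ Q := by
      have hα : (Q * ((d * p + b : ℕ) + p) + 1 : ℤ) ≤ s.den * (A + q) := by
        rw [hy, mul_div_assoc', lt_div_iff₀ hQ0] at hlow
        have : (Q * ((d * p + b : ℕ) + p) : ℤ) < s.den * (A + q) := by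
          have : (Q * ((d * p + b : ℕ) + p) : ℚ) < s.den * (A + q) := by linarith
          exact_mod_cast this
        exact this
      have hβ : (s.den * A + 0 : ℤ) ≤ Q * (d * p + b : ℕ) := by
        rw [hy, mul_div_assoc', div_le_iff₀ hQ0] at hup
        have : (s.den * A : ℚ) ≤ Q * (d * p + b : ℕ) := by linarith
        rw [add_zero]
        exact_mod_cast this
      have := le_num_of_neighbours (by omega) (by omega) hdetA hα hβ
      omega
    have hm2' : floorDiff r⁻¹ (A - 1) = m := by
      have hper : ((d * q : ℤ) : ℚ) * r⁻¹ = (d * p : ℤ) := by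
        push_cast
        rw [mul_assoc, hx]
      rw [← hm2, ← floorDiff_periodic hper (a - 1)]
      congr 1
      rw [hA]
      push_cast
      ring
    refine ⟨d, hd1, by omega, ?_⟩
    rw [block_eq_window hx ha haq hS1 hS2]
    refine cyclicContains_CS (k := 0) (N := q + A) hs0 hs1' hQ (by omega) (by omega) ?_
    rw [show (d + 1) * q + a = q + A by rw [hA]; ring, Nat.cast_zero]
    exact window_ceilDiff_of_between hx0 hq (by omega) (by exact_mod_cast hx) hdetA
      (by exact_mod_cast hup) (by exact_mod_cast hlow) hm1 hm2'

end Heckoid
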